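/- arXiv:1607.01308 — 2 statements merged into one kernel-verified Lean document; each statement's English description precedes it below -/
import Mathlib

section
/- The function λ_− attains a global minimum at a positive wavenumber: there exists k0 > 0 such that λ_−(k0) ≤ λ_−(k) for all k > 0 (and hence, by evenness of λ_−, for all k ≠ 0). -/
/-- The discriminant `D(k)`. -/
noncomputable def Dfun (ρ βl βu k : ℝ) : ℝ :=
  ((1 - ρ + βl * k ^ 2) - (Real.tanh |k| + ρ) * (1 + βu * k ^ 2)) ^ 2
    + (4 * ρ / Real.cosh |k| ^ 2) * (1 - ρ + βl * k ^ 2) * (1 + βu * k ^ 2)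

/-- The slow branch `λ₋(k)` of the dispersion relation. -/
noncomputable def lamM (ρ βl βu k : ℝ) : ℝ :=
  ((1 - ρ + βl * k ^ 2) + (1 + βu * k ^ 2) * (Real.tanh |k| + ρ) - Real.sqrt (Dfun ρ βl βu k))
    / (2 * |k| * (1 + ρ * Real.tanh |k|))

/-- The conjugate of the numerator of `λ₋(k)`, with `+√D` in place of `-√D` and the absolute
values dropped so that it is differentiable at the origin. -/
noncomputable def lamConj (ρ βl βu k : ℝ) : ℝ :=
  (1 - ρ + βl * k ^ 2) + (1 + βu * k ^ 2) * (Real.tanh k + ρ) +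
    Real.sqrt (((1 - ρ + βl * k ^ 2) - (Real.tanh k + ρ) * (1 + βu * k ^ 2)) ^ 2
      + (4 * ρ / Real.cosh k ^ 2) * (1 - ρ + βl * k ^ 2) * (1 + βu * k ^ 2))

theorem tanh_pos_of_pos {k : ℝ} (hk : 0 < k) : 0 < Real.tanh k := by
  rw [Real.tanh_eq_sinh_div_cosh]
  exact div_pos (Real.sinh_pos_iff.mpr hk) (Real.cosh_pos k)

theorem hasDerivAt_tanh_zero : HasDerivAt Real.tanh 1 0 := by
  have h := (Real.hasDerivAt_sinh 0).div (Real.hasDerivAt_cosh 0) (Real.cosh_pos 0).ne'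
  have e : Real.tanh = Real.sinh / Real.cosh := by
    funext x
    simp [Real.tanh_eq_sinh_div_cosh]
  rw [e]
  simpa using h

theorem real_tanh_monotone : Monotone Real.tanh := by
  intro x y hxy
  have h := Real.sinh_nonneg_iff.mpr (sub_nonneg.mpr hxy)
  rw [Real.sinh_sub] at h
  rw [Real.tanh_eq_sinh_div_cosh, Real.tanh_eq_sinh_div_cosh,
    div_le_div_iff₀ (Real.cosh_pos x) (Real.cosh_pos y)]
  linarith

theorem tanh_le_self {k : ℝ} (hk : 0 ≤ k) : Real.tanh k ≤ k := by
  have hderiv (x : ℝ) : HasDerivAt (fun x => x * Real.cosh x - Real.sinh x)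
      (x * Real.sinh x) x :=
    (((hasDerivAt_id x).mul (Real.hasDerivAt_cosh x)).sub (Real.hasDerivAt_sinh x)).congr_deriv
      (by simp)
  have hmono := monotoneOn_of_deriv_nonneg (convex_Ici (0 : ℝ))
    (fun x _ => (hderiv x).continuousAt.continuousWithinAt)
    (fun x _ => (hderiv x).differentiableAt.differentiableWithinAt) fun x hx => by
      rw [interior_Ici] at hx
      rw [(hderiv x).deriv]
      exact mul_nonneg hx.le (Real.sinh_nonneg_iff.mpr hx.le)
  have h := hmono Set.self_mem_Ici hk hk
  simp only [zero_mul, Real.sinh_zero, sub_zero] at h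
  rw [Real.tanh_eq_sinh_div_cosh, div_le_iff₀ (Real.cosh_pos k)]
  linarith

theorem continuous_real_tanh : Continuous Real.tanh := by
  have e : Real.tanh = fun x => Real.sinh x / Real.cosh x := funext Real.tanh_eq_sinh_div_cosh
  rw [e]
  exact Real.continuous_sinh.div Real.continuous_cosh fun x => (Real.cosh_pos x).ne'

theorem one_div_cosh_sq (k : ℝ) : 1 / Real.cosh k ^ 2 = 1 - Real.tanh k ^ 2 := by
  have h := Real.cosh_sq k
  have hc := (Real.cosh_pos k).ne'
  rw [Real.tanh_eq_sinh_div_cosh]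
  field_simp
  linarith

/-- Rationalizing the numerator of `λ₋` using the product of the two branches. -/
theorem lamM_eq_of_pos {ρ βl βu k : ℝ} (hρ : ρ ∈ Set.Ioo (0 : ℝ) 1) (hβl : 0 < βl)
    (hβu : 0 < βu) (hk : 0 < k) :
    0 < lamConj ρ βl βu k ∧
    lamConj ρ βl βu k ≤ 2 * ((1 - ρ + βl * k ^ 2) + (1 + βu * k ^ 2) * (Real.tanh k + ρ)) ∧
    lamM ρ βl βu k = 2 * (1 - ρ + βl * k ^ 2) * (1 + βu * k ^ 2) * (Real.tanh k / k)
      / lamConj ρ βl βu k := by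
  obtain ⟨h0, h1⟩ := hρ
  have ht := tanh_pos_of_pos hk
  have hA : 0 < 1 - ρ + βl * k ^ 2 := by have := sub_pos.mpr h1; positivity
  have hB : 0 < 1 + βu * k ^ 2 := by positivity
  have hc := one_div_cosh_sq k
  unfold lamM Dfun lamConj
  rw [abs_of_pos hk]
  have hq : 4 * ρ / Real.cosh k ^ 2 = 4 * ρ * (1 - Real.tanh k ^ 2) := by
    rw [← hc]; ring
  have hq0 : 0 ≤ 4 * ρ * (1 - Real.tanh k ^ 2) := by rw [← hq]; positivity
  rw [hq]
  generalize 1 - ρ + βl * k ^ 2 = A at *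
  generalize 1 + βu * k ^ 2 = B at *
  generalize Real.tanh k = t at *
  have hD : 0 ≤ (A - (t + ρ) * B) ^ 2 + 4 * ρ * (1 - t ^ 2) * A * B := by positivity
  have hs := Real.sq_sqrt hD
  have hs0 := Real.sqrt_nonneg ((A - (t + ρ) * B) ^ 2 + 4 * ρ * (1 - t ^ 2) * A * B)
  have hS : 0 < A + B * (t + ρ) := by positivity
  generalize √((A - (t + ρ) * B) ^ 2 + 4 * ρ * (1 - t ^ 2) * A * B) = s at *
  have hprod : 0 < A * B * t * (1 + ρ * t) := by positivity
  refine ⟨by linarith, ?_, ?_⟩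
  · have : s ≤ A + B * (t + ρ) := abs_le_of_sq_le_sq' (by nlinarith) hS.le |>.2
    linarith
  · have h3 : A + B * (t + ρ) + s ≠ 0 := by linarith
    have h4 : 1 + ρ * t ≠ 0 := by positivity
    rw [div_eq_div_iff (by positivity) h3]
    field_simp
    linear_combination (-1 : ℝ) * hs

theorem lamConj_zero (ρ βl βu : ℝ) : lamConj ρ βl βu 0 = 2 := by
  have e : (1 - ρ - ρ) ^ 2 + 4 * ρ * (1 - ρ) = 1 := by ring
  simp [lamConj, e]
  norm_num

theorem continuous_lamConj (ρ βl βu : ℝ) : Continuous (lamConj ρ βl βu) := by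
  have := continuous_real_tanh
  have := Real.continuous_cosh
  unfold lamConj
  refine Continuous.add (by fun_prop) (Continuous.sqrt ?_)
  refine Continuous.add (by fun_prop) ?_
  refine Continuous.mul (Continuous.mul ?_ (by fun_prop)) (by fun_prop)
  exact Continuous.div (by fun_prop) (by fun_prop) fun x => (pow_pos (Real.cosh_pos x) 2).ne'

theorem hasDerivAt_lamConj_zero (ρ βl βu : ℝ) : HasDerivAt (lamConj ρ βl βu) (2 * ρ) 0 := by
  have hA : HasDerivAt (fun k : ℝ => 1 - ρ + βl * k ^ 2) 0 0 := by
    simpa using ((hasDerivAt_pow 2 (0 : ℝ)).const_mul βl).const_add (1 - ρ)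
  have hB : HasDerivAt (fun k : ℝ => 1 + βu * k ^ 2) 0 0 := by
    simpa using ((hasDerivAt_pow 2 (0 : ℝ)).const_mul βu).const_add 1
  have hT : HasDerivAt (fun k => Real.tanh k + ρ) 1 0 := hasDerivAt_tanh_zero.add_const ρ
  have hC : HasDerivAt (fun k => 4 * ρ / Real.cosh k ^ 2) 0 0 := by
    have h := (hasDerivAt_const (0 : ℝ) (4 * ρ)).div ((Real.hasDerivAt_cosh 0).pow 2) (by simp)
    exact h.congr_deriv (by simp)
  have hD := ((hA.sub (hT.mul hB)).pow 2).add ((hC.mul hA).mul hB)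
  have e : (1 - ρ - ρ) ^ 2 + 4 * ρ * (1 - ρ) = 1 := by ring
  have h := (hA.add (hB.mul hT)).add (hD.sqrt (by simp [e]))
  refine h.congr_deriv ?_
  simp [e]
  ring

/-- The slow branch dips strictly below its long-wave limit `1 - ρ`. -/
theorem exists_lamM_lt {ρ βl βu : ℝ} (hρ : ρ ∈ Set.Ioo (0 : ℝ) 1) (hβl : 0 < βl)
    (hβu : 0 < βu) : ∃ k, 0 < k ∧ lamM ρ βl βu k < 1 - ρ := by
  obtain ⟨h0, h1⟩ := hρ
  have hP : HasDerivAt (fun k : ℝ => 2 * (1 - ρ + βl * k ^ 2) * (1 + βu * k ^ 2)) 0 0 := by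
    have hA := ((((hasDerivAt_pow 2 (0 : ℝ)).const_mul βl).const_add (1 - ρ)).const_mul 2).mul
      (((hasDerivAt_pow 2 (0 : ℝ)).const_mul βu).const_add 1)
    exact hA.congr_deriv (by simp)
  have hd := (((hasDerivAt_lamConj_zero ρ βl βu).const_mul (1 - ρ)).sub hP).tendsto_slope_zero_right
  have hpos : 0 < (1 - ρ) * (2 * ρ) - 0 := by
    have := sub_pos.mpr h1
    simp only [sub_zero]
    positivity
  obtain ⟨k, hk, hk0 : 0 < k⟩ :=
    ((hd.eventually_const_lt hpos).and self_mem_nhdsWithin).exists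
  refine ⟨k, hk0, ?_⟩
  have hdiff := pos_of_smul_pos_left hk (inv_nonneg.mpr hk0.le)
  simp only [zero_add, Pi.sub_apply, lamConj_zero] at hdiff
  obtain ⟨hc, -, he⟩ := lamM_eq_of_pos ⟨h0, h1⟩ hβl hβu hk0
  rw [he, div_lt_iff₀ hc]
  have hA : 0 < 1 - ρ + βl * k ^ 2 := by have := sub_pos.mpr h1; positivity
  have ht : Real.tanh k / k ≤ 1 := (div_le_one hk0).mpr (tanh_le_self hk0.le)
  have := mul_le_of_le_one_right
    (by positivity : 0 ≤ 2 * (1 - ρ + βl * k ^ 2) * (1 + βu * k ^ 2)) ht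
  norm_num at hdiff
  linarith

theorem tendsto_lamM_zero {ρ βl βu : ℝ} (hρ : ρ ∈ Set.Ioo (0 : ℝ) 1) (hβl : 0 < βl)
    (hβu : 0 < βu) :
    Filter.Tendsto (lamM ρ βl βu) (nhdsWithin 0 (Set.Ioi 0)) (nhds (1 - ρ)) := by
  have hT : Filter.Tendsto (fun k => Real.tanh k / k) (nhdsWithin 0 (Set.Ioi 0)) (nhds 1) := by
    have h := hasDerivAt_tanh_zero.tendsto_slope_zero_right
    refine h.congr fun k => ?_
    simp [div_eq_inv_mul]
  have hN : Filter.Tendsto (fun k : ℝ => 2 * (1 - ρ + βl * k ^ 2) * (1 + βu * k ^ 2))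
      (nhdsWithin 0 (Set.Ioi 0)) (nhds (2 * (1 - ρ))) := by
    have : Continuous fun k : ℝ => 2 * (1 - ρ + βl * k ^ 2) * (1 + βu * k ^ 2) := by fun_prop
    simpa using (this.tendsto 0).mono_left nhdsWithin_le_nhds
  have hC := ((continuous_lamConj ρ βl βu).tendsto 0).mono_left
    (nhdsWithin_le_nhds (s := Set.Ioi (0 : ℝ)))
  rw [lamConj_zero] at hC
  have h := (hN.mul hT).div hC two_ne_zero
  rw [show 2 * (1 - ρ) * 1 / 2 = 1 - ρ by ring] at h
  refine h.congr' ?_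
  filter_upwards [self_mem_nhdsWithin] with k hk
  exact (lamM_eq_of_pos hρ hβl hβu hk).2.2.symm

theorem tendsto_lamM_atTop {ρ βl βu : ℝ} (hρ : ρ ∈ Set.Ioo (0 : ℝ) 1) (hβl : 0 < βl)
    (hβu : 0 < βu) : Filter.Tendsto (lamM ρ βl βu) Filter.atTop Filter.atTop := by
  obtain ⟨h0, h1⟩ := hρ
  have hc : 0 < βl * βu * Real.tanh 1 / (3 + βl + 2 * βu) := by
    have := tanh_pos_of_pos one_pos
    positivity
  refine Filter.tendsto_atTop_mono' _ ?_ (Filter.tendsto_id.const_mul_atTop hc)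
  filter_upwards [Filter.eventually_ge_atTop 1] with k hk
  have hk0 : 0 < k := by linarith
  obtain ⟨hpos, hle, he⟩ := lamM_eq_of_pos ⟨h0, h1⟩ hβl hβu hk0
  have ht1 := tanh_pos_of_pos one_pos
  have ht : Real.tanh 1 ≤ Real.tanh k := real_tanh_monotone hk
  have htk : Real.tanh k ≤ 1 := (Real.tanh_lt_one k).le
  have hk2 : 1 ≤ k ^ 2 := one_le_pow₀ hk
  have hbd : lamConj ρ βl βu k ≤ 2 * ((3 + βl + 2 * βu) * k ^ 2) := by
    refine hle.trans ?_
    have : (1 + βu * k ^ 2) * (Real.tanh k + ρ) ≤ (1 + βu * k ^ 2) * 2 := by gcongr; linarith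
    nlinarith
  rw [he, le_div_iff₀ hpos, id]
  have hA : βl * k ^ 2 ≤ 1 - ρ + βl * k ^ 2 := by linarith
  have hB : βu * k ^ 2 ≤ 1 + βu * k ^ 2 := by linarith
  calc βl * βu * Real.tanh 1 / (3 + βl + 2 * βu) * k * lamConj ρ βl βu k
      ≤ βl * βu * Real.tanh 1 / (3 + βl + 2 * βu) * k * (2 * ((3 + βl + 2 * βu) * k ^ 2)) := by
        gcongr
    _ = 2 * (βl * k ^ 2) * (βu * k ^ 2) * (Real.tanh 1 / k) := by
        field_simp
    _ ≤ _ := by gcongr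

theorem continuousOn_lamM {ρ βl βu : ℝ} (hρ : ρ ∈ Set.Ioo (0 : ℝ) 1) (hβl : 0 < βl)
    (hβu : 0 < βu) : ContinuousOn (lamM ρ βl βu) (Set.Ioi 0) := by
  have : ContinuousOn (fun k => 2 * (1 - ρ + βl * k ^ 2) * (1 + βu * k ^ 2) *
      (Real.tanh k / k) / lamConj ρ βl βu k) (Set.Ioi 0) := by
    refine ContinuousOn.div (ContinuousOn.mul (by fun_prop) ?_)
      (continuous_lamConj ρ βl βu).continuousOn
      fun k hk => (lamM_eq_of_pos hρ hβl hβu hk).1.ne'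
    exact continuous_real_tanh.continuousOn.div continuousOn_id fun k hk => (ne_of_gt hk)
  exact this.congr fun k hk => (lamM_eq_of_pos hρ hβl hβu hk).2.2


/-- `λ₋` attains a global minimum at some positive wavenumber `k₀`:
`λ₋(k₀) ≤ λ₋(k)` for all `k > 0`, and hence (by evenness) for all `k ≠ 0`. -/
theorem lamM_attains_min (ρ βl βu : ℝ) (hρ : ρ ∈ Set.Ioo (0:ℝ) 1) (hβl : 0 < βl)
    (hβu : 0 < βu) :
    ∃ k0 : ℝ, 0 < k0 ∧ (∀ k : ℝ, 0 < k → lamM ρ βl βu k0 ≤ lamM ρ βl βu k) ∧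
      ∀ k : ℝ, k ≠ 0 → lamM ρ βl βu k0 ≤ lamM ρ βl βu k := by
  have key : ∃ k0 : ℝ, 0 < k0 ∧ ∀ k : ℝ, 0 < k → lamM ρ βl βu k0 ≤ lamM ρ βl βu k := by
    obtain ⟨k1, hk1, hlt⟩ := exists_lamM_lt hρ hβl hβu
    obtain ⟨ε, hε, hεlt⟩ := mem_nhdsGT_iff_exists_Ioo_subset.mp
      ((tendsto_lamM_zero hρ hβl hβu).eventually_const_lt hlt)
    obtain ⟨M, hM⟩ := Filter.eventually_atTop.mp
      ((tendsto_lamM_atTop hρ hβl hβu).eventually_ge_atTop (lamM ρ βl βu k1))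
    have hε' : (0 : ℝ) < ε := hε
    have hpos : ∀ k ∈ Set.Icc (min ε k1) (max M k1), 0 < k := fun k hk =>
      (lt_min hε' hk1).trans_le hk.1
    have hmem : k1 ∈ Set.Icc (min ε k1) (max M k1) := ⟨min_le_right _ _, le_max_right _ _⟩
    obtain ⟨k0, hk0, hmin⟩ := isCompact_Icc.exists_isMinOn ⟨k1, hmem⟩
      ((continuousOn_lamM hρ hβl hβu).mono hpos)
    refine ⟨k0, hpos k0 hk0, fun k hk => ?_⟩
    rcases lt_or_ge k (min ε k1) with h | h
    · exact (hmin hmem).trans (hεlt ⟨hk, h.trans_le (min_le_left _ _)⟩ : _ < _).le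
    rcases le_or_gt k (max M k1) with h' | h'
    · exact hmin ⟨h, h'⟩
    · exact (hmin hmem).trans (hM k ((le_max_left _ _).trans h'.le))
  obtain ⟨k0, hk0, h⟩ := key
  refine ⟨k0, hk0, h, fun k hk => ?_⟩
  have heven : lamM ρ βl βu |k| = lamM ρ βl βu k := by simp [lamM, Dfun]
  exact heven ▸ h |k| (abs_pos.mpr hk)
end

section
/- Suppose k0 > 0 satisfies Assumption 1, and let v0 ∈ ℝ², v0 ≠ 0, be a vector with g(k0)v0 = 0. Then the function h(k) := g(k)v0·v0 satisfies A2 := h''(k0) > 0; that is, the second derivative of k ↦ (P(k) − λ_−(k0)F(k))v0·v0 at k = k0 is strictly positive. -/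
open Matrix

/-- The matrix `P(k)`. -/
noncomputable def Pmat (ρ βl βu k : ℝ) : Matrix (Fin 2) (Fin 2) ℝ :=
  !![1 - ρ + βl * k ^ 2, 0; 0, ρ * (1 + βu * k ^ 2)]

/-- The matrix `F(k)`; `coth t = cosh t / sinh t`. -/
noncomputable def Fmat (ρ k : ℝ) : Matrix (Fin 2) (Fin 2) ℝ :=
  !![|k| + ρ * |k| * (Real.cosh |k| / Real.sinh |k|), -(ρ * |k| / Real.sinh |k|);
     -(ρ * |k| / Real.sinh |k|), ρ * |k| * (Real.cosh |k| / Real.sinh |k|)]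

/-- The matrix `g(k) = P(k) − λ₋(k₀) F(k)`. -/
noncomputable def gmat (ρ βl βu k0 k : ℝ) : Matrix (Fin 2) (Fin 2) ℝ :=
  Pmat ρ βl βu k - lamM ρ βl βu k0 • Fmat ρ k

open Filter Topology

/-- At a local minimum the second derivative is nonnegative. -/
theorem IsLocalMin.deriv_deriv_nonneg {f : ℝ → ℝ} {x : ℝ} (hmin : IsLocalMin f x)
    (hc : ContinuousAt f x) : 0 ≤ deriv (deriv f) x := by
  by_contra! hneg
  have hmax : IsLocalMax f x := isLocalMax_of_deriv_deriv_neg hneg hmin.deriv_eq_zero hc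
  have hconst : f =ᶠ[𝓝 x] fun _ => f x := by
    filter_upwards [hmin, hmax] with y h₁ h₂ using le_antisymm h₂ h₁
  have h₀ : deriv (deriv f) x = 0 := by
    rw [hconst.deriv.deriv_eq]
    simp
  exact hneg.ne h₀

/-- If `h` touches `(L - L x) * q` from above at `x`, where `L` has a local minimum, then the
second derivative of `h` at `x` is at least that of `L` times `q x`. -/
theorem deriv_deriv_mul_le_of_isLocalMin {L q h : ℝ → ℝ} {x : ℝ} (hL : ContDiffAt ℝ 2 L x)
    (hq : ContDiffAt ℝ 2 q x) (hh : ContDiffAt ℝ 2 h x) (hmin : IsLocalMin L x)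
    (hle : ∀ᶠ k in 𝓝 x, (L k - L x) * q k ≤ h k) (hx : h x = 0) :
    deriv (deriv L) x * q x ≤ deriv (deriv h) x := by
  have key : ∀ {f : ℝ → ℝ}, ContDiffAt ℝ 2 f x →
      (∀ᶠ k in 𝓝 x, DifferentiableAt ℝ f k) ∧ DifferentiableAt ℝ (deriv f) x := by
    intro f hf
    refine ⟨(hf.eventually (by simp)).mono fun k hk => hk.differentiableAt (by simp), ?_⟩
    have h1 : ContDiffAt ℝ 1 (deriv f) x := hf.derivWithin (by norm_num)
    exact h1.differentiableAt (by simp)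
  obtain ⟨hL₁, hL₂⟩ := key hL
  obtain ⟨hq₁, hq₂⟩ := key hq
  obtain ⟨hh₁, hh₂⟩ := key hh
  have hdmin : IsLocalMin (fun k => h k - (L k - L x) * q k) x := by
    filter_upwards [hle] with k hk
    simp only [hx, sub_self, zero_mul]
    linarith
  have hd := hdmin.deriv_deriv_nonneg
    (hh.continuousAt.sub ((hL.continuousAt.sub continuousAt_const).mul hq.continuousAt))
  have hd₁ : deriv (fun k => h k - (L k - L x) * q k) =ᶠ[𝓝 x]
      fun k => deriv h k - (deriv L k * q k + (L k - L x) * deriv q k) := by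
    filter_upwards [hL₁, hq₁, hh₁] with k h₁ h₂ h₃
    exact (h₃.hasDerivAt.sub ((h₁.hasDerivAt.sub_const (L x)).mul h₂.hasDerivAt)).deriv
  have hd₂ := (hh₂.hasDerivAt.sub ((hL₂.hasDerivAt.mul hq₁.self_of_nhds.hasDerivAt).add
    ((hL₁.self_of_nhds.hasDerivAt.sub_const (L x)).mul hq₂.hasDerivAt))).deriv
  rw [hd₁.deriv_eq] at hd
  have hd₃ := hd.trans_eq hd₂
  simp only [hmin.deriv_eq_zero, sub_self, zero_mul, add_zero] at hd₃
  linarith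

theorem Fmat_quadForm_pos {ρ k : ℝ} (hρ : 0 < ρ) (hk : 0 < k) {v : Fin 2 → ℝ} (hv : v ≠ 0) :
    0 < (Fmat ρ k *ᵥ v) ⬝ᵥ v := by
  have hS : 0 < Real.sinh k := Real.sinh_pos_iff.2 hk
  have hC : 1 < Real.cosh k := Real.one_lt_cosh.2 hk.ne'
  have hsum : 0 < v 0 ^ 2 + v 1 ^ 2 := by
    by_contra! h
    apply hv
    ext i
    fin_cases i <;> simp <;> nlinarith [sq_nonneg (v 0), sq_nonneg (v 1)]
  have heq : (Fmat ρ k *ᵥ v) ⬝ᵥ v = k * v 0 ^ 2 + ρ * k / Real.sinh k *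
      ((Real.cosh k - 1) * (v 0 ^ 2 + v 1 ^ 2) + (v 0 - v 1) ^ 2) := by
    simp [Fmat, abs_of_pos hk, Matrix.mulVec, dotProduct, Fin.sum_univ_two]
    field_simp
    ring
  rw [heq]
  have := mul_pos (sub_pos.2 hC) hsum
  positivity

theorem Dfun_pos {ρ βl βu : ℝ} (hρ : ρ ∈ Set.Ioo (0:ℝ) 1) (hβl : 0 < βl) (hβu : 0 < βu) (k : ℝ) :
    0 < Dfun ρ βl βu k := by
  obtain ⟨h0, h1⟩ := hρ
  have : 0 < 1 - ρ := sub_pos.2 h1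
  have := Real.cosh_pos |k|
  unfold Dfun
  positivity

theorem Real.tanh_pos_of_pos {x : ℝ} (hx : 0 < x) : 0 < Real.tanh x := by
  rw [Real.tanh_eq_sinh_div_cosh]
  exact div_pos (Real.sinh_pos_iff.2 hx) (Real.cosh_pos x)

theorem lamM_contDiffAt {ρ βl βu k : ℝ} (hρ : ρ ∈ Set.Ioo (0:ℝ) 1) (hβl : 0 < βl) (hβu : 0 < βu)
    (hk : 0 < k) : ContDiffAt ℝ 2 (lamM ρ βl βu) k := by
  have habs : ContDiffAt ℝ 2 (fun k : ℝ => |k|) k := contDiffAt_abs hk.ne'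
  have hC : ContDiffAt ℝ 2 (fun k : ℝ => Real.cosh |k|) k :=
    Real.contDiff_cosh.contDiffAt.comp k habs
  have hS : ContDiffAt ℝ 2 (fun k : ℝ => Real.sinh |k|) k :=
    Real.contDiff_sinh.contDiffAt.comp k habs
  have hT : ContDiffAt ℝ 2 (fun k : ℝ => Real.tanh |k|) k := by
    simp only [Real.tanh_eq_sinh_div_cosh]
    exact hS.div hC (Real.cosh_pos _).ne'
  have hD : ContDiffAt ℝ 2 (Dfun ρ βl βu) k := by
    have hC' : ContDiffAt ℝ 2 (fun k : ℝ => 4 * ρ / Real.cosh |k| ^ 2) k :=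
      contDiffAt_const.div (hC.pow 2) (pow_pos (Real.cosh_pos _) 2).ne'
    unfold Dfun
    fun_prop
  have hR := hD.sqrt (Dfun_pos hρ hβl hβu k).ne'
  have hden : 2 * |k| * (1 + ρ * Real.tanh |k|) ≠ 0 := by
    rw [abs_of_pos hk]
    have := Real.tanh_pos_of_pos hk
    have := hρ.1
    positivity
  unfold lamM
  exact ContDiffAt.div (by fun_prop) (by fun_prop) hden

theorem Fmat_quadForm_contDiffAt (ρ : ℝ) {k : ℝ} (hk : 0 < k) (v : Fin 2 → ℝ) :
    ContDiffAt ℝ 2 (fun k => (Fmat ρ k *ᵥ v) ⬝ᵥ v) k := by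
  have habs : ContDiffAt ℝ 2 (fun k : ℝ => |k|) k := contDiffAt_abs hk.ne'
  have hC : ContDiffAt ℝ 2 (fun k : ℝ => Real.cosh |k|) k :=
    Real.contDiff_cosh.contDiffAt.comp k habs
  have hS : ContDiffAt ℝ 2 (fun k : ℝ => Real.sinh |k|) k :=
    Real.contDiff_sinh.contDiffAt.comp k habs
  have hS₀ : Real.sinh |k| ≠ 0 := (Real.sinh_pos_iff.2 (abs_pos.2 hk.ne')).ne'
  have h₁ := hC.div hS hS₀
  have h₂ : ContDiffAt ℝ 2 (fun k : ℝ => ρ * |k| / Real.sinh |k|) k :=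
    (contDiffAt_const.mul habs).div hS hS₀
  simp only [Fmat, Matrix.mulVec, dotProduct, Fin.sum_univ_two, Matrix.of_apply, Matrix.cons_val_zero,
    Matrix.cons_val_one, Matrix.cons_val', Matrix.cons_val_fin_one]
  fun_prop

theorem Pmat_quadForm_contDiffAt (ρ βl βu k : ℝ) (v : Fin 2 → ℝ) :
    ContDiffAt ℝ 2 (fun k => (Pmat ρ βl βu k *ᵥ v) ⬝ᵥ v) k := by
  simp only [Pmat, Matrix.mulVec, dotProduct, Fin.sum_univ_two, Matrix.of_apply, Matrix.cons_val_zero,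
    Matrix.cons_val_one, Matrix.cons_val', Matrix.cons_val_fin_one]
  fun_prop

/-- If `z` is the smaller root of the rescaled dispersion polynomial
`abS - z (aC + b(S + ρC)) + z² (C + ρS)`, then the associated quadratic form is nonnegative. -/
theorem quadForm_nonneg_of_smaller_root {ρ a b S C r z : ℝ} (hρ : 0 < ρ) (hb : 0 < b) (hS : 0 < S)
    (hC : 0 < C) (hCS : C ^ 2 = S ^ 2 + 1) (hr₀ : 0 ≤ r)
    (hr : r ^ 2 = (a * C - (S + ρ * C) * b) ^ 2 + 4 * ρ * a * b)
    (hz : 2 * z * (C + ρ * S) = a * C + b * (S + ρ * C) - r) (x y : ℝ) :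
    0 ≤ (a * S - z * (S + ρ * C)) * x ^ 2 + 2 * (z * ρ) * x * y + ρ * (b * S - z * C) * y ^ 2 := by
  have hE : 0 < C + ρ * S := by positivity
  have hroot : a * b * S - z * (a * C + b * (S + ρ * C)) + z ^ 2 * (C + ρ * S) = 0 := by
    refine (mul_eq_zero.1 ?_).resolve_left (mul_pos four_pos hE).ne'
    linear_combination hr + (2 * z * (C + ρ * S) - (a * C + b * (S + ρ * C)) - r) * hz
      - 4 * ρ * a * b * hCS
  have hB : 0 < b * S - z * C := by
    have hW : (a * C ^ 2 + b * C * (S + ρ * C) - 2 * b * S * (C + ρ * S)) ^ 2 < (r * C) ^ 2 := by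
      have heq : (r * C) ^ 2 - (a * C ^ 2 + b * C * (S + ρ * C) - 2 * b * S * (C + ρ * S)) ^ 2 =
          4 * ρ * b ^ 2 * S * (C + ρ * S) := by
        linear_combination C ^ 2 * hr + (4 * ρ * b ^ 2 * S * (C + ρ * S) - 4 * ρ * a * b * C ^ 2) * hCS
      have : 0 < 4 * ρ * b ^ 2 * S * (C + ρ * S) := by positivity
      linarith
    have hlt := (abs_lt.1 (abs_lt_of_sq_lt_sq hW (by positivity))).2
    refine pos_of_mul_pos_right (a := 2 * (C + ρ * S)) ?_ (by positivity)
    linear_combination hlt + C * hz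
  have hdet : (a * S - z * (S + ρ * C)) * (b * S - z * C) = z ^ 2 * ρ := by
    linear_combination S * hroot + z ^ 2 * ρ * hCS
  refine nonneg_of_mul_nonneg_right (a := b * S - z * C) ?_ hB
  have hsq : 0 ≤ ρ * (z * x + (b * S - z * C) * y) ^ 2 := by positivity
  linear_combination hsq - x ^ 2 * hdet

/-- `P(k) - λ₋(k) F(k)` is positive semidefinite. -/
theorem lamM_mul_Fmat_quadForm_le {ρ βl βu k : ℝ} (hρ : ρ ∈ Set.Ioo (0:ℝ) 1) (hβl : 0 < βl)
    (hβu : 0 < βu) (hk : 0 < k) (v : Fin 2 → ℝ) :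
    lamM ρ βl βu k * ((Fmat ρ k *ᵥ v) ⬝ᵥ v) ≤ (Pmat ρ βl βu k *ᵥ v) ⬝ᵥ v := by
  have hS : 0 < Real.sinh k := Real.sinh_pos_iff.2 hk
  have hC : 0 < Real.cosh k := Real.cosh_pos k
  have hD₀ := Dfun_pos hρ hβl hβu k
  have hρ₀ := hρ.1
  have hlam : lamM ρ βl βu k * (2 * k * (1 + ρ * Real.tanh k)) =
      (1 - ρ + βl * k ^ 2) + (1 + βu * k ^ 2) * (Real.tanh k + ρ) - √(Dfun ρ βl βu k) := by
    have := Real.tanh_pos_of_pos hk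
    unfold lamM
    rw [abs_of_pos hk]
    field_simp
  have hD : Dfun ρ βl βu k = ((1 - ρ + βl * k ^ 2) - (Real.tanh k + ρ) * (1 + βu * k ^ 2)) ^ 2
    + (4 * ρ / Real.cosh k ^ 2) * (1 - ρ + βl * k ^ 2) * (1 + βu * k ^ 2) := by
    rw [Dfun, abs_of_pos hk]
  have hform : (Pmat ρ βl βu k *ᵥ v) ⬝ᵥ v - lamM ρ βl βu k * ((Fmat ρ k *ᵥ v) ⬝ᵥ v) =
      (((1 - ρ + βl * k ^ 2) * Real.sinh k
          - lamM ρ βl βu k * k * (Real.sinh k + ρ * Real.cosh k)) * v 0 ^ 2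
        + 2 * (lamM ρ βl βu k * k * ρ) * v 0 * v 1
        + ρ * ((1 + βu * k ^ 2) * Real.sinh k - lamM ρ βl βu k * k * Real.cosh k) * v 1 ^ 2)
      / Real.sinh k := by
    simp [Pmat, Fmat, abs_of_pos hk, Matrix.mulVec, dotProduct, Fin.sum_univ_two]
    field_simp
    ring
  rw [Real.tanh_eq_sinh_div_cosh] at hlam hD
  have hR := Real.sq_sqrt hD₀.le
  rw [← sub_nonneg, hform]
  refine div_nonneg (quadForm_nonneg_of_smaller_root (r := √(Dfun ρ βl βu k) * Real.cosh k)
    hρ₀ (by positivity) hS hC (Real.cosh_sq k) (by positivity) ?_ ?_ _ _) hS.le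
  · rw [mul_pow, hR, hD]
    field_simp
  · field_simp at hlam
    linear_combination hlam

/-- Under Assumption 1, if `v₀ ≠ 0` satisfies `g(k₀)v₀ = 0`, then
`A₂ := h''(k₀) > 0` where `h(k) = g(k)v₀·v₀`. -/
theorem A2_pos (ρ βl βu : ℝ) (hρ : ρ ∈ Set.Ioo (0:ℝ) 1) (hβl : 0 < βl)
    (hβu : 0 < βu) (k0 : ℝ) (hk0 : 0 < k0)
    (hmin : ∀ k : ℝ, k ≠ 0 → k ≠ k0 → k ≠ -k0 → lamM ρ βl βu k0 < lamM ρ βl βu k)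
    (hnondeg : 0 < deriv (deriv (lamM ρ βl βu)) k0)
    (v0 : Fin 2 → ℝ) (hv0 : v0 ≠ 0) (hker : gmat ρ βl βu k0 k0 *ᵥ v0 = 0) :
    0 < deriv (deriv (fun k => (gmat ρ βl βu k0 k *ᵥ v0) ⬝ᵥ v0)) k0 := by
  have hpos : ∀ᶠ k in 𝓝 k0, 0 < k := lt_mem_nhds hk0
  have hlocmin : IsLocalMin (lamM ρ βl βu) k0 := by
    filter_upwards [hpos] with k hk
    rcases eq_or_ne k k0 with rfl | hne
    · exact le_rfl
    · exact (hmin k hk.ne' hne (by linarith)).le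
  have hg : ∀ k, (gmat ρ βl βu k0 k *ᵥ v0) ⬝ᵥ v0 =
      (Pmat ρ βl βu k *ᵥ v0) ⬝ᵥ v0 - lamM ρ βl βu k0 * ((Fmat ρ k *ᵥ v0) ⬝ᵥ v0) := by
    intro k
    rw [gmat, Matrix.sub_mulVec, Matrix.smul_mulVec, sub_dotProduct, smul_dotProduct, smul_eq_mul]
  have hF := Fmat_quadForm_contDiffAt ρ hk0 v0
  refine (mul_pos hnondeg (Fmat_quadForm_pos hρ.1 hk0 hv0)).trans_le
    (deriv_deriv_mul_le_of_isLocalMin (lamM_contDiffAt hρ hβl hβu hk0) hF ?_ hlocmin ?_ ?_)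
  · simp only [hg]
    exact (Pmat_quadForm_contDiffAt ρ βl βu k0 v0).sub (contDiffAt_const.mul hF)
  · filter_upwards [hpos] with k hk
    rw [hg]
    linarith [lamM_mul_Fmat_quadForm_le hρ hβl hβu hk v0]
  · simp [hker]
end
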